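/- Let a, b be integers and c an odd positive integer with gcd(a, c) = 1, and let φ be an integer satisfying 4aφ ≡ 1 (mod c). Then G(a, b, c) = exp(−2πi φ b²/c) · (a|c) · √c if c ≡ 1 (mod 4), and G(a, b, c) = exp(−2πi φ b²/c) · (a|c) · i · √c if c ≡ 3 (mod 4). -/

import Mathlib

open Finset Real

/-- The generalized quadratic Gauß sum `G(a, b, c) = ∑_{l=0}^{c-1} exp(2πi(a l² + b l)/c)`. -/
noncomputable def gaussSumG (a b : ℤ) (c : ℕ) : ℂ :=
  ∑ l ∈ Finset.range c, Complex.exp (2 * Real.pi * Complex.I * ((a : ℂ) * l ^ 2 + (b : ℂ) * l) / c)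

/-- The quadratic Gauss sum `∑ x : ZMod c, exp (2πi a x² / c)`. -/
noncomputable def quadSum (a : ℤ) (c : ℕ) [NeZero c] : ℂ :=
  ∑ x : ZMod c, ZMod.stdAddChar ((a : ZMod c) * x ^ 2)

theorem sum_range_natCast_zmod {M : Type*} [AddCommMonoid M] (c : ℕ) [NeZero c] (f : ZMod c → M) :
    ∑ l ∈ range c, f (l : ZMod c) = ∑ x : ZMod c, f x := by
  refine Finset.sum_bij' (fun l _ => (l : ZMod c)) (fun x _ => x.val) ?_ ?_ ?_ ?_ ?_
  · simp
  · intro x _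
    simpa using ZMod.val_lt x
  · intro l hl
    exact ZMod.val_cast_of_lt (by simpa using hl)
  · simp
  · simp

theorem sum_range_mul_eq {M : Type*} [AddCommMonoid M] (f : ℕ → M) (k n : ℕ) :
    ∑ x ∈ range (k * n), f x = ∑ y ∈ range k, ∑ z ∈ range n, f (y + k * z) := by
  rw [Finset.sum_comm]
  induction n with
  | zero => simp
  | succ n ih => rw [Nat.mul_succ, Finset.sum_range_add, ih, Finset.sum_range_succ]; simp [add_comm]

theorem quadSum_sq_mul (a : ℤ) (n m : ℕ) [NeZero n] [NeZero m] (h : IsUnit ((2 * a : ℤ) : ZMod n)) :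
    quadSum a (n ^ 2 * m) = n * quadSum a m := by
  have hn : (n : ℂ) ≠ 0 := NeZero.ne _
  have hm : (m : ℂ) ≠ 0 := NeZero.ne _
  have key : ∀ y z : ℕ, (ZMod.stdAddChar
        ((a : ZMod (n ^ 2 * m)) * ((y + n * m * z : ℕ) : ZMod (n ^ 2 * m)) ^ 2) : ℂ)
      = ZMod.stdAddChar ((a : ZMod (n ^ 2 * m)) * (y : ZMod (n ^ 2 * m)) ^ 2) *
        ZMod.stdAddChar ((z : ZMod n) * (((2 * a : ℤ) : ZMod n) * (y : ZMod n))) := by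
    intro y z
    have h1 := ZMod.stdAddChar_coe (N := n ^ 2 * m) (a * (y + n * m * z) ^ 2)
    have h2 := ZMod.stdAddChar_coe (N := n ^ 2 * m) (a * y ^ 2)
    have h3 := ZMod.stdAddChar_coe (N := n) (z * (2 * a * y))
    push_cast at h1 h2 h3 ⊢
    rw [h1, h2, h3, ← Complex.exp_add, Complex.exp_eq_exp_iff_exists_int]
    refine ⟨a * m * z ^ 2, ?_⟩
    push_cast
    field_simp
    ring
  have key2 : ∀ w : ℕ, (ZMod.stdAddChar
        ((a : ZMod (n ^ 2 * m)) * ((n * w : ℕ) : ZMod (n ^ 2 * m)) ^ 2) : ℂ)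
      = ZMod.stdAddChar ((a : ZMod m) * (w : ZMod m) ^ 2) := by
    intro w
    have h1 := ZMod.stdAddChar_coe (N := n ^ 2 * m) (a * (n * w) ^ 2)
    have h2 := ZMod.stdAddChar_coe (N := m) (a * w ^ 2)
    push_cast at h1 h2 ⊢
    rw [h1, h2]
    congr 1
    field_simp
  have inner : ∀ y : ℕ, ∑ z ∈ range n, (ZMod.stdAddChar
      ((z : ZMod n) * (((2 * a : ℤ) : ZMod n) * (y : ZMod n))) : ℂ) =
      if (y : ZMod n) = 0 then (n : ℂ) else 0 := by
    intro y
    rw [sum_range_natCast_zmod n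
      (fun x : ZMod n => (ZMod.stdAddChar (x * (((2 * a : ℤ) : ZMod n) * (y : ZMod n))) : ℂ)),
      AddChar.sum_mulShift _ (ZMod.isPrimitive_stdAddChar n)]
    simp only [h.mul_right_eq_zero, ZMod.card]
    split_ifs <;> simp
  unfold quadSum
  rw [← sum_range_natCast_zmod, ← sum_range_natCast_zmod]
  have hr : range (n ^ 2 * m) = range (n * m * n) := congrArg range (by ring)
  rw [hr, sum_range_mul_eq]
  simp_rw [key, ← Finset.mul_sum, inner]
  rw [sum_range_mul_eq, Finset.sum_eq_single_of_mem 0 (by simp [Nat.pos_of_neZero])]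
  · simp_rw [zero_add, key2, Finset.mul_sum]
    refine Finset.sum_congr rfl fun w _ => ?_
    simp [mul_comm]
  · intro s hs hs0
    refine Finset.sum_eq_zero fun w _ => ?_
    rw [if_neg, mul_zero]
    simp only [Nat.cast_add, Nat.cast_mul, CharP.cast_eq_zero, zero_mul, add_zero,
      ZMod.natCast_eq_zero_iff]
    exact fun hd => hs0 (Nat.eq_zero_of_dvd_of_lt hd (by simpa using hs))

theorem quadSum_mul (a u v : ℤ) (m n : ℕ) [NeZero m] [NeZero n] (huv : u * n + v * m = 1)
    (h : m.Coprime n) :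
    quadSum a (m * n) = quadSum (a * u) m * quadSum (a * v) n := by
  have hn : (n : ℂ) ≠ 0 := NeZero.ne _
  have hm : (m : ℂ) ≠ 0 := NeZero.ne _
  unfold quadSum
  rw [Finset.sum_mul_sum, ← Finset.sum_product', Finset.univ_product_univ]
  refine Fintype.sum_equiv (ZMod.chineseRemainder h).toEquiv _ _ fun x => ?_
  obtain ⟨k, rfl⟩ := ZMod.intCast_surjective x
  have hk : (ZMod.chineseRemainder h).toEquiv (k : ZMod (m * n)) = ((k : ZMod m), (k : ZMod n)) := by
    change (ZMod.chineseRemainder h) (k : ZMod (m * n)) = _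
    rw [map_intCast]
    rfl
  rw [hk]
  have h1 := ZMod.stdAddChar_coe (N := m * n) (a * k ^ 2)
  have h2 := ZMod.stdAddChar_coe (N := m) (a * u * k ^ 2)
  have h3 := ZMod.stdAddChar_coe (N := n) (a * v * k ^ 2)
  push_cast at h1 h2 h3 ⊢
  rw [h1, h2, h3, ← Complex.exp_add]
  congr 1
  have huv' : (u * n + v * m : ℂ) = 1 := by exact_mod_cast huv
  field_simp
  linear_combination -(a * k ^ 2 : ℂ) * huv'

theorem quadSum_prime (a : ℤ) (p : ℕ) [Fact p.Prime] (hp : p ≠ 2) (ha : (a : ZMod p) ≠ 0) :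
    quadSum a p = legendreSym p a * quadSum 1 p := by
  have H : ∀ b : ℤ, (b : ZMod p) ≠ 0 → quadSum b p =
      (legendreSym p b : ℂ) * gaussSum ((quadraticChar (ZMod p)).ringHomComp (Int.castRingHom ℂ))
        ZMod.stdAddChar := by
    intro b hb
    have hsq : ∀ f : ZMod p → ℂ, ∑ x, f (x ^ 2) =
        ∑ t, ((quadraticChar (ZMod p) t : ℂ) + 1) * f t := by
      intro f
      rw [← Finset.sum_fiberwise (s := univ) (g := fun x : ZMod p => x ^ 2)]
      refine Finset.sum_congr rfl fun t _ => ?_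
      rw [Finset.sum_congr rfl (g := fun _ => f t) (by intro x hx; simp at hx; rw [hx])]
      have := quadraticChar_card_sqrts (F := ZMod p) (by rwa [ZMod.ringChar_zmod_n]) t
      rw [Finset.sum_const, nsmul_eq_mul]
      congr 1
      rw [show ((quadraticChar (ZMod p) t : ℂ) + 1) = ((quadraticChar (ZMod p) t + 1 : ℤ) : ℂ) by
        push_cast; rfl, ← this]
      simp
    have h0 : ∑ t : ZMod p, (ZMod.stdAddChar ((b : ZMod p) * t) : ℂ) = 0 := by
      have := AddChar.sum_mulShift (b : ZMod p) (ZMod.isPrimitive_stdAddChar p)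
      simpa [hb, mul_comm] using this
    unfold quadSum
    rw [hsq fun t => ZMod.stdAddChar ((b : ZMod p) * t)]
    simp_rw [add_mul, one_mul]
    rw [Finset.sum_add_distrib, h0, add_zero]
    have hg := gaussSum_mulShift ((quadraticChar (ZMod p)).ringHomComp (Int.castRingHom ℂ))
      (ZMod.stdAddChar (N := p)) (Units.mk0 _ hb)
    rw [← hg, ← mul_assoc]
    have h1 : (legendreSym p b : ℂ) * ((quadraticChar (ZMod p)).ringHomComp (Int.castRingHom ℂ))
        (Units.mk0 _ hb : (ZMod p)ˣ) = 1 := by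
      have := legendreSym.sq_one p hb
      simp only [MulChar.ringHomComp_apply, Units.val_mk0, eq_intCast]
      change (legendreSym p b : ℂ) * ((legendreSym p b : ℤ) : ℂ) = 1
      rw [← sq]
      exact_mod_cast this
    rw [h1, one_mul]
    simp [gaussSum, AddChar.mulShift_apply]
  rw [H a ha, H 1 (by simp), legendreSym.at_one]
  simp

theorem isUnit_intCast_zmod (a : ℤ) (n : ℕ) (h : IsCoprime a n) : IsUnit (a : ZMod n) := by
  obtain ⟨u, v, huv⟩ := h
  refine IsUnit.of_mul_eq_one (u : ZMod n) ?_
  have := congrArg (Int.cast : ℤ → ZMod n) huv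
  push_cast at this
  simpa [mul_comm] using this

theorem quadSum_eq_jacobiSym_mul (c : ℕ) : ∀ [NeZero c] (a : ℤ), Odd c → IsCoprime a c →
    quadSum a c = jacobiSym a c * quadSum 1 c := by
  induction c using Nat.strong_induction_on with
  | _ c ih =>
  intro _ a hodd ha
  by_cases h1 : c = 1
  · subst h1
    simp [quadSum, Subsingleton.elim _ (0 : ZMod 1)]
  obtain ⟨p, hp, m, rfl⟩ := Nat.exists_prime_and_dvd h1
  have : Fact p.Prime := ⟨hp⟩
  have hm0 : m ≠ 0 := by rintro rfl; simp at hodd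
  have : NeZero m := ⟨hm0⟩
  have hpo : Odd p := Nat.Odd.of_mul_left hodd
  have hmo : Odd m := Nat.Odd.of_mul_right hodd
  have hp2 : p ≠ 2 := by rintro rfl; exact absurd hpo (by decide)
  push_cast at ha
  have hap : IsCoprime a p := ha.of_mul_right_left
  have ham : IsCoprime a m := ha.of_mul_right_right
  by_cases hd : p ∣ m
  · obtain ⟨k, rfl⟩ := hd
    have : NeZero k := ⟨by rintro rfl; simp at hm0⟩
    have hko : Odd k := Nat.Odd.of_mul_right hmo
    push_cast at ham
    have hak : IsCoprime a k := ham.of_mul_right_right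
    have h2 : IsCoprime (2 : ℤ) p := by
      rw [Int.isCoprime_iff_gcd_eq_one]
      exact (Nat.coprime_two_left).2 hpo
    have hs := quadSum_sq_mul a p k (isUnit_intCast_zmod _ _ (h2.mul_left hap))
    have hs1 := quadSum_sq_mul 1 p k (isUnit_intCast_zmod _ _ (by simpa using h2))
    have hlt : k < p * (p * k) := by
      have := hp.two_le
      have := Nat.pos_of_neZero k
      nlinarith [Nat.mul_le_mul hp.two_le hp.two_le]
    have hk := ih k hlt a hko hak
    have hj : jacobiSym a (p * (p * k)) = jacobiSym a k := by
      rw [jacobiSym.mul_right, jacobiSym.mul_right, ← mul_assoc, ← sq, jacobiSym.sq_one, one_mul]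
      exact Int.isCoprime_iff_gcd_eq_one.1 hap
    have e : p * (p * k) = p ^ 2 * k := by ring
    rw [hj]
    simp only [e]
    rw [hs, hs1, hk]
    ring
  · have hcop : p.Coprime m := (Nat.Prime.coprime_iff_not_dvd hp).2 hd
    obtain ⟨v, u, huv⟩ := (Nat.isCoprime_iff_coprime.2 hcop : IsCoprime (p : ℤ) m)
    have huv' : u * m + v * p = 1 := by linarith
    have hup : IsCoprime u p := ⟨m, v, by linarith⟩
    have hvm : IsCoprime v m := ⟨p, u, by linarith⟩
    have hlt : m < p * m := by
      have := hp.two_le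
      have := Nat.pos_of_neZero m
      nlinarith
    have hP : ∀ b : ℤ, IsCoprime b p → quadSum b p = jacobiSym b p * quadSum 1 p := by
      intro b hb
      rw [quadSum_prime b p hp2 (isUnit_intCast_zmod _ _ hb).ne_zero,
        jacobiSym.legendreSym.to_jacobiSym]
    rw [quadSum_mul a u v p m huv' hcop, quadSum_mul 1 u v p m huv' hcop, one_mul, one_mul,
      hP _ (hap.mul_left hup), hP _ hup, ih m hlt _ hmo (ham.mul_left hvm), ih m hlt _ hmo hvm,
      jacobiSym.mul_right, jacobiSym.mul_left, jacobiSym.mul_left]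
    push_cast
    ring

theorem tendsto_jacobiTheta₂_ofReal_atTop {ι : Type*} {l : Filter ι} {τ : ι → ℂ} (x : ℝ)
    (hτ : Filter.Tendsto (fun i => (τ i).im) l Filter.atTop) :
    Filter.Tendsto (fun i => jacobiTheta₂ x (τ i)) l (nhds 1) := by
  have hsum : Summable fun n : ℤ => Real.exp (-π * n ^ 2) := by
    have := ((summable_jacobiTheta₂_term_iff 0 Complex.I).2 (by simp)).norm
    simpa [norm_jacobiTheta₂_term] using this
  have h1 : (∑' n : ℤ, if n = 0 then (1 : ℂ) else 0) = 1 := by simp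
  rw [← h1]
  refine tendsto_tsum_of_dominated_convergence hsum (fun n => ?_) ?_
  · split_ifs with hn
    · subst hn
      simpa [jacobiTheta₂_term] using tendsto_const_nhds
    · rw [tendsto_zero_iff_norm_tendsto_zero]
      simp only [norm_jacobiTheta₂_term, Complex.ofReal_im, mul_zero, sub_zero]
      refine Real.tendsto_exp_atBot.comp (hτ.const_mul_atTop_of_neg ?_)
      have : (0 : ℝ) < (n : ℝ) ^ 2 := by positivity
      nlinarith [Real.pi_pos]
  · filter_upwards [hτ.eventually_ge_atTop 1] with i hi n
    simp only [norm_jacobiTheta₂_term, Complex.ofReal_im, mul_zero, sub_zero]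
    refine Real.exp_le_exp.2 ?_
    have : 0 ≤ π * (n : ℝ) ^ 2 := by positivity
    nlinarith

/-- If `r ↦ exp (πi α r²)` is `m`-periodic, then `θ(α + δ)` splits over residue classes mod `m`,
each of which can be transformed by the functional equation of the theta function. -/
theorem jacobiTheta₂_zero_add_of_periodic (m : ℕ) [NeZero m] (α δ : ℂ) (hα : α.im = 0)
    (hδ : 0 < δ.im) (hper : ∀ r k : ℤ, Complex.exp (π * Complex.I * (k * m + r) ^ 2 * α) =
      Complex.exp (π * Complex.I * r ^ 2 * α)) :
    jacobiTheta₂ 0 (α + δ) = 1 / (-Complex.I * (m ^ 2 * δ)) ^ (1 / 2 : ℂ) *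
      ∑ r ∈ range m, Complex.exp (π * Complex.I * r ^ 2 * α) *
        jacobiTheta₂ ((r / m : ℝ) : ℂ) (-1 / (m ^ 2 * δ)) := by
  have hm : (m : ℂ) ≠ 0 := NeZero.ne _
  have hδ0 : δ ≠ 0 := by rintro rfl; simp at hδ
  have hs : Summable fun n : ℤ => jacobiTheta₂_term n 0 (α + δ) :=
    (summable_jacobiTheta₂_term_iff _ _).2 (by simpa [hα] using hδ)
  have hs' : Summable fun q : Fin m × ℤ =>
      jacobiTheta₂_term ((Int.divModEquiv m).symm (Equiv.prodComm _ _ q)) 0 (α + δ) :=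
    (Equiv.prodComm _ _).summable_iff.2 ((Int.divModEquiv m).symm.summable_iff.2 hs)
  have hfe : ∀ r : ℕ, jacobiTheta₂ (m * r * δ) (m ^ 2 * δ) =
      1 / (-Complex.I * (m ^ 2 * δ)) ^ (1 / 2 : ℂ) * Complex.exp (-π * Complex.I * r ^ 2 * δ) *
        jacobiTheta₂ ((r / m : ℝ) : ℂ) (-1 / (m ^ 2 * δ)) := by
    intro r
    rw [jacobiTheta₂_functional_equation]
    congr 2
    · congr 1
      field_simp
    · push_cast
      field_simp
  rw [jacobiTheta₂, ← (Int.divModEquiv m).symm.tsum_eq, ← (Equiv.prodComm _ _).tsum_eq,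
    hs'.tsum_prod, tsum_fintype, Finset.mul_sum,
    ← Fin.sum_univ_eq_sum_range (fun r => 1 / (-Complex.I * (m ^ 2 * δ)) ^ (1 / 2 : ℂ) *
      (Complex.exp (π * Complex.I * r ^ 2 * α) *
        jacobiTheta₂ ((r / m : ℝ) : ℂ) (-1 / (m ^ 2 * δ))))]
  refine Finset.sum_congr rfl fun r _ => ?_
  have hterm : ∀ k : ℤ, jacobiTheta₂_term ((Int.divModEquiv m).symm (k, r)) 0 (α + δ) =
      Complex.exp (π * Complex.I * (r : ℕ) ^ 2 * α) * Complex.exp (π * Complex.I * (r : ℕ) ^ 2 * δ) *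
        jacobiTheta₂_term k (m * (r : ℕ) * δ) (m ^ 2 * δ) := by
    intro k
    have := hper (r : ℕ) k
    push_cast at this
    rw [← this, jacobiTheta₂_term, jacobiTheta₂_term, ← Complex.exp_add, ← Complex.exp_add]
    congr 1
    simp only [Int.divModEquiv, Equiv.coe_fn_symm_mk]
    push_cast
    ring
  simp only [Equiv.prodComm_apply, Prod.swap_prod_mk, hterm]
  rw [tsum_mul_left, ← jacobiTheta₂, hfe]
  have hexp : Complex.exp (π * Complex.I * (r : ℕ) ^ 2 * δ) *
      Complex.exp (-π * Complex.I * (r : ℕ) ^ 2 * δ) = 1 := by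
    rw [← Complex.exp_add, ← Complex.exp_zero]
    congr 1
    ring
  linear_combination Complex.exp (π * Complex.I * (r : ℕ) ^ 2 * α) *
    (1 / (-Complex.I * (m ^ 2 * δ)) ^ (1 / 2 : ℂ)) *
        jacobiTheta₂ (((r : ℕ) / m : ℝ) : ℂ) (-1 / (m ^ 2 * δ)) * hexp

theorem ofReal_mul_cpow {x : ℝ} (hx : 0 < x) {w : ℂ} (hw : w ≠ 0) (s : ℂ) :
    ((x : ℂ) * w) ^ s = (x : ℂ) ^ s * w ^ s := by
  have hx' : (x : ℂ) ≠ 0 := by exact_mod_cast hx.ne'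
  rw [Complex.cpow_def_of_ne_zero (mul_ne_zero hx' hw), Complex.cpow_def_of_ne_zero hx',
    Complex.cpow_def_of_ne_zero hw, Complex.log_ofReal_mul hx hw, Complex.ofReal_log hx.le,
    add_mul, Complex.exp_add]

/-- The case of the Landsberg–Schaar relation that evaluates `∑ r < c, exp (2πi r² / c)`. -/
theorem sum_exp_sq_div (c : ℕ) [NeZero c] :
    ∑ r ∈ range c, Complex.exp (π * Complex.I * r ^ 2 * (2 / c)) =
      1 / (-Complex.I * (2 / c)) ^ (1 / 2 : ℂ) * (1 + Complex.exp (-(π * Complex.I * c / 2))) := by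
  have hc : (c : ℂ) ≠ 0 := NeZero.ne _
  have hc0 : (0 : ℝ) < c := by exact_mod_cast Nat.pos_of_neZero c
  let τ : ℝ → ℂ := fun T => 2 / c + Complex.I / (c ^ 2 * T)
  have key : ∀ T : ℝ, 0 < T →
      ∑ r ∈ range c, Complex.exp (π * Complex.I * r ^ 2 * (2 / c)) *
        jacobiTheta₂ ((r / c : ℝ) : ℂ) (Complex.I * T) =
      1 / (-Complex.I * τ T) ^ (1 / 2 : ℂ) * (1 / (2 / (c * τ T)) ^ (1 / 2 : ℂ) *
        ∑ s ∈ range 2, Complex.exp (π * Complex.I * s ^ 2 * (-c / 2)) *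
          jacobiTheta₂ ((s / 2 : ℝ) : ℂ) (Complex.I * T - 1 / (2 * c))) := by
    intro T hT
    have hT' : (T : ℂ) ≠ 0 := by exact_mod_cast hT.ne'
    have hτim : 0 < (τ T).im := by
      have : τ T = ((2 / c : ℝ) : ℂ) + ((1 / (c ^ 2 * T) : ℝ) : ℂ) * Complex.I := by
        simp only [τ]; push_cast; ring
      rw [this]
      simp only [Complex.add_im, Complex.ofReal_im, Complex.im_ofReal_mul, Complex.I_im]
      positivity
    have hτ0 : τ T ≠ 0 := by intro h; rw [h] at hτim; simp at hτim
    have hinv : -1 / τ T = -c / 2 + Complex.I / (2 * c * T * τ T) := by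
      have : τ T * (c ^ 2 * T) = 2 * c * T + Complex.I := by
        simp only [τ]
        field_simp
      field_simp
      linear_combination this
    have hδ : 0 < (Complex.I / (2 * c * T * τ T)).im := by
      have h1 : (-1 / τ T).im = (τ T).im / Complex.normSq (τ T) := by
        rw [neg_div, one_div, Complex.neg_im, Complex.inv_im]
        ring
      have h2 : (-(c : ℂ) / 2).im = 0 := by
        rw [show -(c : ℂ) / 2 = ((-c / 2 : ℝ) : ℂ) by push_cast; rfl, Complex.ofReal_im]
      rw [hinv, Complex.add_im, h2, zero_add] at h1
      rw [h1]
      exact div_pos hτim (Complex.normSq_pos.2 hτ0)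
    have hδ₁ : 0 < (Complex.I / (c ^ 2 * T)).im := by
      rw [show (Complex.I / (c ^ 2 * T) : ℂ) = ((1 / (c ^ 2 * T) : ℝ) : ℂ) * Complex.I by
        push_cast; ring, Complex.im_ofReal_mul, Complex.I_im]
      positivity
    have hα : (2 / c : ℂ).im = 0 := by
      rw [show (2 / c : ℂ) = ((2 / c : ℝ) : ℂ) by push_cast; rfl, Complex.ofReal_im]
    have hα' : (-c / 2 : ℂ).im = 0 := by
      rw [show (-c / 2 : ℂ) = ((-c / 2 : ℝ) : ℂ) by push_cast; rfl, Complex.ofReal_im]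
    have hτ : τ T = 2 / c + Complex.I / (c ^ 2 * T) := rfl
    have P1 := jacobiTheta₂_zero_add_of_periodic c (2 / c) (Complex.I / (c ^ 2 * T)) hα hδ₁ (by
      intro r k
      rw [Complex.exp_eq_exp_iff_exists_int]
      refine ⟨k ^ 2 * c + 2 * k * r, ?_⟩
      push_cast
      field_simp
      ring)
    have P2 := jacobiTheta₂_functional_equation 0 (τ T)
    have P3 := jacobiTheta₂_zero_add_of_periodic 2 (-c / 2) (Complex.I / (2 * c * T * τ T))
        hα' hδ (by
      intro r k
      rw [Complex.exp_eq_exp_iff_exists_int]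
      refine ⟨-c * (k ^ 2 + k * r), ?_⟩
      push_cast
      ring)
    rw [← hinv] at P3
    rw [zero_div, P3, hτ, P1, ← hτ] at P2
    have e1 : -Complex.I * (c ^ 2 * (Complex.I / (c ^ 2 * T))) = ((1 / T : ℝ) : ℂ) := by
      push_cast
      field_simp
      simp
    have e2 : -1 / (c ^ 2 * (Complex.I / (c ^ 2 * T))) = Complex.I * T := by
      field_simp
      simp
    have e3 : -Complex.I * (((2 : ℕ) : ℂ) ^ 2 * (Complex.I / (2 * c * T * τ T))) =
        ((1 / T : ℝ) : ℂ) * (2 / (c * τ T)) := by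
      push_cast
      field_simp
      rw [Complex.I_sq]
      ring
    have e4 : -1 / (((2 : ℕ) : ℂ) ^ 2 * (Complex.I / (2 * c * T * τ T))) =
        Complex.I * T - 1 / (2 * c) := by
      have : τ T * (c ^ 2 * T) = 2 * c * T + Complex.I := by
        simp only [τ]
        field_simp
      generalize τ T = t at this hτ0 ⊢
      push_cast
      field_simp
      linear_combination -this - 2 * c * T * Complex.I_sq
    rw [e1, e2, e3, e4, ofReal_mul_cpow (by positivity)
      (div_ne_zero two_ne_zero (mul_ne_zero hc hτ0))] at P2
    have hT2 : ((1 / T : ℝ) : ℂ) ^ (1 / 2 : ℂ) ≠ 0 := by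
      rw [Complex.cpow_ne_zero_iff_of_exponent_ne_zero (by norm_num)]
      exact_mod_cast (by positivity : (1 / T : ℝ) ≠ 0)
    have e5 : Complex.exp (-π * Complex.I * 0 ^ 2 / τ T) = 1 := by simp
    have hcancel : ∀ u v w x y : ℂ, u ≠ 0 → 1 / u * x = v * (1 / (u * w) * y) →
        x = v * (1 / w * y) := by
      intro u v w x y hu h
      have := congrArg (u * ·) h
      simp only [one_div, mul_inv] at this ⊢
      rw [mul_inv_cancel_left₀ hu] at this
      rw [this, mul_left_comm u v, mul_assoc u⁻¹, mul_inv_cancel_left₀ hu]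
    rw [e5, mul_one] at P2
    exact hcancel _ _ _ _ _ hT2 P2
  have hτlim : Filter.Tendsto τ Filter.atTop (nhds (2 / c)) := by
    have : Filter.Tendsto (fun T : ℝ => (2 / c + ((T⁻¹ : ℝ) : ℂ) * (Complex.I / c ^ 2) : ℂ))
        Filter.atTop (nhds (2 / c + ((0 : ℝ) : ℂ) * (Complex.I / c ^ 2))) :=
      (((Complex.continuous_ofReal.tendsto 0).comp tendsto_inv_atTop_zero).mul_const _).const_add _
    rw [Complex.ofReal_zero, zero_mul, add_zero] at this
    refine this.congr fun T => ?_
    simp only [τ]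
    push_cast
    rw [div_mul_eq_div_div, div_eq_mul_inv (Complex.I / (c : ℂ) ^ 2), mul_comm]
  have him₁ : Filter.Tendsto (fun T : ℝ => (Complex.I * T).im) Filter.atTop Filter.atTop := by
    simp only [Complex.I_mul_im, Complex.ofReal_re]
    exact Filter.tendsto_id
  have him₂ : Filter.Tendsto (fun T : ℝ => (Complex.I * T - 1 / (2 * c)).im)
      Filter.atTop Filter.atTop := by
    have : (1 / (2 * c) : ℂ).im = 0 := by
      rw [show (1 / (2 * c) : ℂ) = ((1 / (2 * c) : ℝ) : ℂ) by push_cast; rfl, Complex.ofReal_im]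
    simpa only [Complex.sub_im, this, sub_zero] using him₁
  have hL : Filter.Tendsto (fun T : ℝ => ∑ r ∈ range c,
      Complex.exp (π * Complex.I * r ^ 2 * (2 / c)) *
        jacobiTheta₂ ((r / c : ℝ) : ℂ) (Complex.I * T)) Filter.atTop
      (nhds (∑ r ∈ range c, Complex.exp (π * Complex.I * r ^ 2 * (2 / c)) * 1)) :=
    tendsto_finsetSum _ fun r _ => (tendsto_jacobiTheta₂_ofReal_atTop _ him₁).const_mul _
  have hR : Filter.Tendsto (fun T : ℝ => ∑ s ∈ range 2,
      Complex.exp (π * Complex.I * s ^ 2 * (-c / 2)) *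
        jacobiTheta₂ ((s / 2 : ℝ) : ℂ) (Complex.I * T - 1 / (2 * c))) Filter.atTop
      (nhds (∑ s ∈ range 2, Complex.exp (π * Complex.I * s ^ 2 * (-c / 2)) * 1)) :=
    tendsto_finsetSum _ fun r _ => (tendsto_jacobiTheta₂_ofReal_atTop _ him₂).const_mul _
  have hslit : -Complex.I * (2 / c) ∈ Complex.slitPlane := by
    refine Or.inr ?_
    rw [show -Complex.I * (2 / c) = ((-(2 / c) : ℝ) : ℂ) * Complex.I by push_cast; ring,
      Complex.im_ofReal_mul, Complex.I_im]
    have : (0 : ℝ) < 2 / c := by positivity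
    linarith
  have hone : (2 / (c * (2 / c)) : ℂ) = 1 := by field_simp
  have h1 : Filter.Tendsto (fun T => 1 / (-Complex.I * τ T) ^ (1 / 2 : ℂ)) Filter.atTop
      (nhds (1 / (-Complex.I * (2 / c)) ^ (1 / 2 : ℂ))) := by
    refine tendsto_const_nhds.div ((hτlim.const_mul _).cpow tendsto_const_nhds hslit) ?_
    rw [Complex.cpow_ne_zero_iff_of_exponent_ne_zero (by norm_num)]
    exact Complex.slitPlane_ne_zero hslit
  have h2 : Filter.Tendsto (fun T => 1 / (2 / (c * τ T)) ^ (1 / 2 : ℂ)) Filter.atTop (nhds 1) := by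
    have : Filter.Tendsto (fun T => 2 / (c * τ T)) Filter.atTop (nhds 1) := by
      rw [← hone]
      exact tendsto_const_nhds.div (hτlim.const_mul _)
        (mul_ne_zero hc (div_ne_zero two_ne_zero hc))
    have h := this.cpow (tendsto_const_nhds (x := (1 / 2 : ℂ))) Complex.one_mem_slitPlane
    rw [Complex.one_cpow] at h
    simpa only [one_div, inv_one] using h.inv₀ one_ne_zero
  have hlim := tendsto_nhds_unique
    (hL.congr' ((Filter.eventually_gt_atTop 0).mono key)) (h1.mul (h2.mul hR))
  simp only [mul_one, one_mul, Finset.sum_range_succ, Finset.sum_range_zero, zero_add] at hlim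
  rw [hlim]
  congr 2
  · simp
  · congr 1
    push_cast
    ring

theorem quadSum_one_eq_sqrt_mul (c : ℕ) [NeZero c] :
    quadSum 1 c = √c * ((1 + (-Complex.I) ^ c) / (1 - Complex.I)) := by
  have hc0 : (0 : ℝ) < c := by exact_mod_cast Nat.pos_of_neZero c
  have hexp : ∀ n : ℕ, Complex.exp (-(π * Complex.I * n / 2)) = (-Complex.I) ^ n := by
    intro n
    rw [← Complex.exp_neg_pi_div_two_mul_I, ← Complex.exp_nat_mul]
    congr 1
    ring
  have hq : quadSum 1 c = ∑ r ∈ range c, Complex.exp (π * Complex.I * r ^ 2 * (2 / c)) := by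
    unfold quadSum
    rw [← sum_range_natCast_zmod]
    refine Finset.sum_congr rfl fun r _ => ?_
    have := ZMod.stdAddChar_coe (N := c) (1 * r ^ 2)
    push_cast at this ⊢
    rw [this]
    congr 1
    ring
  have hI : (1 - Complex.I) ≠ 0 := by
    intro h
    simpa using congrArg Complex.re h
  have h1 := sum_exp_sq_div 1
  rw [hexp 1] at h1
  simp only [Finset.sum_range_one, Nat.cast_one, div_one, pow_one] at h1
  have hsqrt : (((c : ℝ)⁻¹ : ℝ) : ℂ) ^ (1 / 2 : ℂ) = ((√c : ℝ) : ℂ)⁻¹ := by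
    rw [← Complex.ofReal_inv, ← Real.sqrt_inv, Real.sqrt_eq_rpow,
      Complex.ofReal_cpow (by positivity)]
    norm_num
  have hs0 : ((√c : ℝ) : ℂ) ≠ 0 := by
    exact_mod_cast (Real.sqrt_pos.2 hc0).ne'
  rw [hq, sum_exp_sq_div, hexp,
    show -Complex.I * (2 / c) = (((c : ℝ)⁻¹ : ℝ) : ℂ) * (-Complex.I * 2) by push_cast; ring,
    ofReal_mul_cpow (by positivity) (by simp), hsqrt]
  have h1' : 1 / (-Complex.I * 2) ^ (1 / 2 : ℂ) = 1 / (1 - Complex.I) := by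
    rw [eq_div_iff hI]
    simpa [sub_eq_add_neg] using h1.symm
  rw [one_div, mul_inv, inv_inv, ← one_div (_ ^ _), h1']
  ring

theorem quadSum_one_of_mod_four_eq_one (c : ℕ) [NeZero c] (h : c % 4 = 1) :
    quadSum 1 c = √c := by
  have hI : (1 - Complex.I) ≠ 0 := by
    intro h
    simpa using congrArg Complex.re h
  have hp : (-Complex.I) ^ c = -Complex.I := by
    rw [← Nat.div_add_mod c 4, h, pow_add, pow_mul, Even.neg_pow (by decide), Complex.I_pow_four]
    simp
  rw [quadSum_one_eq_sqrt_mul, hp, ← sub_eq_add_neg, div_self hI, mul_one]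

theorem quadSum_one_of_mod_four_eq_three (c : ℕ) [NeZero c] (h : c % 4 = 3) :
    quadSum 1 c = Complex.I * √c := by
  have hI : (1 - Complex.I) ≠ 0 := by
    intro h
    simpa using congrArg Complex.re h
  have hp : (-Complex.I) ^ c = Complex.I := by
    rw [← Nat.div_add_mod c 4, h, pow_add, pow_mul, Even.neg_pow (by decide), Complex.I_pow_four,
      Odd.neg_pow (by decide), Complex.I_pow_three]
    simp
  rw [quadSum_one_eq_sqrt_mul, hp, mul_comm Complex.I]
  congr 1
  rw [div_eq_iff hI]
  linear_combination Complex.I_sq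

theorem gaussSumG_eq_quadSum (a b : ℤ) (c : ℕ) [NeZero c] (φ : ℤ)
    (hφ : 4 * a * φ ≡ 1 [ZMOD (c : ℤ)]) :
    gaussSumG a b c =
      Complex.exp (-(2 * π * Complex.I * (φ : ℂ) * (b : ℂ) ^ 2 / c)) * quadSum a c := by
  have hφ' : (4 * a * φ : ZMod c) = 1 := by
    exact_mod_cast (ZMod.intCast_eq_intCast_iff _ _ _).2 hφ
  have hG : gaussSumG a b c =
      ∑ x : ZMod c, (ZMod.stdAddChar ((a : ZMod c) * x ^ 2 + (b : ZMod c) * x) : ℂ) := by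
    rw [← sum_range_natCast_zmod, gaussSumG]
    refine Finset.sum_congr rfl fun l _ => ?_
    have := ZMod.stdAddChar_coe (N := c) (a * l ^ 2 + b * l)
    push_cast at this
    rw [this]
  have hE : Complex.exp (-(2 * π * Complex.I * (φ : ℂ) * (b : ℂ) ^ 2 / c)) =
      ZMod.stdAddChar (-((φ : ZMod c) * (b : ZMod c) ^ 2)) := by
    have := ZMod.stdAddChar_coe (N := c) (-(φ * b ^ 2))
    push_cast at this
    rw [this]
    congr 1
    ring
  rw [hG, hE, quadSum, Finset.mul_sum]
  refine Fintype.sum_equiv (Equiv.addRight (2 * φ * b : ZMod c)) _ _ fun x => ?_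
  rw [← AddChar.map_add_eq_mul, Equiv.coe_addRight]
  congr 1
  linear_combination (-(b * x) - φ * b ^ 2 : ZMod c) * hφ'

theorem statement3 (a b : ℤ) (c : ℕ) (hc : 0 < c) (hodd : Odd c) (h : Int.gcd a c = 1)
    (φ : ℤ) (hφ : 4 * a * φ ≡ 1 [ZMOD (c : ℤ)]) :
    (c % 4 = 1 → gaussSumG a b c
      = Complex.exp (-(2 * Real.pi * Complex.I * (φ : ℂ) * (b : ℂ) ^ 2 / c))
        * (jacobiSym a c : ℂ) * Real.sqrt c) ∧
    (c % 4 = 3 → gaussSumG a b c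
      = Complex.exp (-(2 * Real.pi * Complex.I * (φ : ℂ) * (b : ℂ) ^ 2 / c))
        * (jacobiSym a c : ℂ) * Complex.I * Real.sqrt c) := by
  have : NeZero c := ⟨hc.ne'⟩
  rw [gaussSumG_eq_quadSum a b c φ hφ,
    quadSum_eq_jacobiSym_mul c a hodd (Int.isCoprime_iff_gcd_eq_one.2 h)]
  refine ⟨fun h1 => ?_, fun h3 => ?_⟩
  · rw [quadSum_one_of_mod_four_eq_one c h1]
    ring
  · rw [quadSum_one_of_mod_four_eq_three c h3]
    ring
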